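/- arXiv:2410.10404 — 2 statements merged into one kernel-verified Lean document; each statement's English description precedes it below -/
import Mathlib

section
/- For every n, T, k with k ≤ T ≤ n < 2^{T/2} and T ≥ 2, the optimal deterministic mistake bound for prediction with n experts' advice under apple tasting feedback on k-realizable sequences of length T is Θ(√(T(k + log n))). -/
/-- A deterministic learner for prediction with expert advice under apple tasting
feedback: it maps the history (experts' predictions and, when the learner predicted `1`,
the revealed true label) together with the current experts' predictions to a prediction. -/
def ExpertLearner (n : ℕ) : Type :=
  List ((Fin n → Bool) × Option Bool) → (Fin n → Bool) → Bool

/-- The feedback history produced by running learner `Lrn` on expert predictions `P`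
and true labels `y` under apple tasting feedback. -/
def histE (n : ℕ) (Lrn : ExpertLearner n) (P : ℕ → Fin n → Bool) (y : ℕ → Bool) :
    ℕ → List ((Fin n → Bool) × Option Bool)
  | 0 => []
  | t + 1 =>
      histE n Lrn P y t ++
        [(P t, if Lrn (histE n Lrn P y t) (P t) = true then some (y t) else none)]

/-- The learner's prediction in round `t`. -/
def predE (n : ℕ) (Lrn : ExpertLearner n) (P : ℕ → Fin n → Bool) (y : ℕ → Bool)
    (t : ℕ) : Bool :=
  Lrn (histE n Lrn P y t) (P t)

/-- The number of mistakes made by the learner during the first `T` rounds. -/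
def mistakesE (n : ℕ) (Lrn : ExpertLearner n) (P : ℕ → Fin n → Bool) (y : ℕ → Bool)
    (T : ℕ) : ℕ :=
  ((Finset.range T).filter (fun t => predE n Lrn P y t ≠ y t)).card

/-! ### Upper bound -/

/-- Weight update. -/
noncomputable def wstepE (n : ℕ) (ε : ℝ) (w : Fin n → ℝ) (e : (Fin n → Bool) × Option Bool) :
    Fin n → ℝ := fun i =>
  w i * (match e.2 with
    | none => if e.1 i = true then 1 + ε else 1
    | some false => if e.1 i = true then 1 / 2 else 1
    | some true => 1)

/-- Weights after a history. -/
noncomputable def wtE (n : ℕ) (ε : ℝ) (h : List ((Fin n → Bool) × Option Bool)) : Fin n → ℝ :=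
  h.foldl (wstepE n ε) (fun _ => 1)

open Classical in
/-- The weighted learner. -/
noncomputable def lrnE (n : ℕ) (ε : ℝ) : ExpertLearner n := fun h p =>
  decide (ε * ∑ i, wtE n ε h i ≤ ∑ i, if p i = true then wtE n ε h i else 0)

lemma wtE_succ (n : ℕ) (ε : ℝ) (L : ExpertLearner n) (P : ℕ → Fin n → Bool) (y : ℕ → Bool) (t : ℕ) :
    wtE n ε (histE n L P y (t+1)) = wstepE n ε (wtE n ε (histE n L P y t))
      (P t, if L (histE n L P y t) (P t) = true then some (y t) else none) := by
  simp [wtE, histE, List.foldl_append]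

lemma wstepE_nonneg (n : ℕ) (ε : ℝ) (hε : 0 ≤ ε) (w : Fin n → ℝ) (hw : ∀ i, 0 ≤ w i) (e) (i) :
    0 ≤ wstepE n ε w e i := by
  unfold wstepE
  apply mul_nonneg (hw i)
  split <;> (try split_ifs) <;> linarith

lemma wtE_nonneg (n : ℕ) (ε : ℝ) (hε : 0 ≤ ε) (L : ExpertLearner n) (P : ℕ → Fin n → Bool)
    (y : ℕ → Bool) (t : ℕ) (i) : 0 ≤ wtE n ε (histE n L P y t) i := by
  induction t generalizing i with
  | zero => simp [histE, wtE]
  | succ t ih => rw [wtE_succ]; exact wstepE_nonneg n ε hε _ ih _ _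

lemma total_step (n : ℕ) (ε : ℝ) (hε : 0 ≤ ε) (P : ℕ → Fin n → Bool)
    (y : ℕ → Bool) (t : ℕ) :
    ∑ i, wtE n ε (histE n (lrnE n ε) P y (t+1)) i ≤
      (∑ i, wtE n ε (histE n (lrnE n ε) P y t) i) *
        Real.exp (if predE n (lrnE n ε) P y t = true ∧ y t = false then -ε/2 else ε^2) := by
  have hw := wtE_nonneg n ε hε (lrnE n ε) P y t
  rw [wtE_succ]
  set h := histE n (lrnE n ε) P y t with hh
  set w := wtE n ε h with hwdef
  have hS : 0 ≤ ∑ i, w i := Finset.sum_nonneg fun i _ => hw i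
  have hp : predE n (lrnE n ε) P y t = lrnE n ε h (P t) := rfl
  rw [hp]
  have e1 : 1 - ε/2 ≤ Real.exp (-ε/2) := by
    have := Real.add_one_le_exp (-ε/2); linarith
  have e2 : 1 + ε^2 ≤ Real.exp (ε^2) := by
    have := Real.add_one_le_exp (ε^2); linarith
  by_cases hl : lrnE n ε h (P t) = true
  · have hl' : ε * ∑ i, w i ≤ ∑ i, if P t i = true then w i else 0 := by
      simpa [lrnE] using hl
    cases hy : y t
    · simp only [hl, if_true, and_self]
      have : ∑ i, wstepE n ε w (P t, some false) i
          = ∑ i, w i - (1/2) * ∑ i, (if P t i = true then w i else 0) := by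
        rw [Finset.mul_sum, ← Finset.sum_sub_distrib]
        apply Finset.sum_congr rfl
        intro i _
        simp only [wstepE]
        split_ifs <;> ring
      rw [this]
      nlinarith
    · simp only [hl, if_true]
      have : ∑ i, wstepE n ε w (P t, some true) i = ∑ i, w i := by
        simp [wstepE]
      rw [this]
      simp
      nlinarith [sq_nonneg ε]
  · have hl' : ∑ i, (if P t i = true then w i else 0) ≤ ε * ∑ i, w i := by
      have : ¬ (ε * ∑ i, w i ≤ ∑ i, if P t i = true then w i else 0) := by
        simpa [lrnE] using hl
      linarith
    simp only [hl]
    have : ∑ i, wstepE n ε w (P t, none) i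
          = ∑ i, w i + ε * ∑ i, (if P t i = true then w i else 0) := by
        rw [Finset.mul_sum, ← Finset.sum_add_distrib]
        apply Finset.sum_congr rfl
        intro i _
        simp only [wstepE]
        split_ifs <;> ring
    simp only [Bool.false_eq_true, false_and, if_false]
    rw [this]
    nlinarith [mul_le_mul_of_nonneg_left hl' hε]

lemma total_bound (n : ℕ) (ε : ℝ) (hε : 0 ≤ ε) (P : ℕ → Fin n → Bool)
    (y : ℕ → Bool) (t : ℕ) :
    ∑ i, wtE n ε (histE n (lrnE n ε) P y t) i ≤
      n * Real.exp (∑ s ∈ Finset.range t,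
        if predE n (lrnE n ε) P y s = true ∧ y s = false then -ε/2 else ε^2) := by
  induction t with
  | zero => simp [histE, wtE]
  | succ t ih =>
    rw [Finset.sum_range_succ, Real.exp_add, ← mul_assoc]
    exact (total_step n ε hε P y t).trans
      (mul_le_mul_of_nonneg_right ih (Real.exp_pos _).le)

lemma single_step (n : ℕ) (ε : ℝ) (hε : 0 ≤ ε) (hε1 : ε ≤ 1) (P : ℕ → Fin n → Bool)
    (y : ℕ → Bool) (j : Fin n) (t : ℕ) :
    wtE n ε (histE n (lrnE n ε) P y t) j *
      Real.exp ((if predE n (lrnE n ε) P y t = false ∧ y t = true then ε/2 else 0)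
        - (if P t j ≠ y t then 1 else 0)) ≤
    wtE n ε (histE n (lrnE n ε) P y (t+1)) j := by
  have hw := wtE_nonneg n ε hε (lrnE n ε) P y t j
  rw [wtE_succ]
  set h := histE n (lrnE n ε) P y t with hh
  have hp : predE n (lrnE n ε) P y t = lrnE n ε h (P t) := rfl
  rw [hp]
  unfold wstepE
  apply mul_le_mul_of_nonneg_left _ hw
  have e1 : Real.exp (-1) ≤ 1/2 := by
    have := Real.exp_neg_one_lt_d9; linarith
  have e2 : Real.exp (ε/2) ≤ 1 + ε := by
    have h3 := Real.add_one_le_exp (-(ε/2))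
    rw [Real.exp_neg] at h3
    have h4 := Real.exp_pos (ε/2)
    have h5 : (-(ε/2) + 1) * Real.exp (ε/2) ≤ 1 := by
      calc _ ≤ (Real.exp (ε/2))⁻¹ * Real.exp (ε/2) := mul_le_mul_of_nonneg_right h3 h4.le
        _ = 1 := inv_mul_cancel₀ h4.ne'
    have h6 : (1:ℝ) ≤ (-(ε/2) + 1) * (1+ε) := by nlinarith
    by_contra hc
    push Not at hc
    nlinarith
  have e3 : Real.exp (ε/2 - 1) ≤ 1 := by
    rw [Real.exp_le_one_iff]; linarith
  have e4 : Real.exp (-1) ≤ 1 + ε := by linarith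
  cases lrnE n ε h (P t) <;> cases hy : y t <;> cases hpp : P t j <;> simp [hpp, e1, e2, e3, e4]
  simpa using e1

lemma single_bound (n : ℕ) (ε : ℝ) (hε : 0 ≤ ε) (hε1 : ε ≤ 1) (P : ℕ → Fin n → Bool)
    (y : ℕ → Bool) (j : Fin n) (t : ℕ) :
    Real.exp (∑ s ∈ Finset.range t,
      ((if predE n (lrnE n ε) P y s = false ∧ y s = true then ε/2 else 0)
        - (if P s j ≠ y s then 1 else 0))) ≤
    wtE n ε (histE n (lrnE n ε) P y t) j := by
  induction t with
  | zero => simp [histE, wtE]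
  | succ t ih =>
    rw [Finset.sum_range_succ, Real.exp_add]
    exact (mul_le_mul_of_nonneg_right ih (Real.exp_pos _).le).trans
      (single_step n ε hε hε1 P y j t)

lemma upper_main (n : ℕ) (hn : 0 < n) (ε : ℝ) (hε : 0 ≤ ε) (hε1 : ε ≤ 1) (P : ℕ → Fin n → Bool)
    (y : ℕ → Bool) (j : Fin n) (T : ℕ) :
    (mistakesE n (lrnE n ε) P y T : ℝ) * (ε/2) ≤
      ((Finset.range T).filter (fun t => P t j ≠ y t)).card + Real.log n + ε^2 * T := by
  have h1 := single_bound n ε hε hε1 P y j T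
  have h2 := total_bound n ε hε P y T
  have h3 : wtE n ε (histE n (lrnE n ε) P y T) j ≤ ∑ i, wtE n ε (histE n (lrnE n ε) P y T) i :=
    Finset.single_le_sum (f := fun i => wtE n ε (histE n (lrnE n ε) P y T) i)
      (fun i _ => wtE_nonneg n ε hε _ P y T i) (Finset.mem_univ j)
  have hn' : (0:ℝ) < n := by exact_mod_cast hn
  have h4 := h1.trans (h3.trans h2)
  rw [← Real.exp_log hn', ← Real.exp_add, Real.exp_le_exp] at h4
  have h5 : (mistakesE n (lrnE n ε) P y T : ℝ) * (ε/2)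
      - ((Finset.range T).filter (fun t => P t j ≠ y t)).card - ε^2 * T ≤
      ∑ s ∈ Finset.range T,
      ((if predE n (lrnE n ε) P y s = false ∧ y s = true then ε/2 else 0)
        - (if P s j ≠ y s then 1 else 0)) - ∑ s ∈ Finset.range T,
        (if predE n (lrnE n ε) P y s = true ∧ y s = false then -ε/2 else ε^2) := by
    have hT : ε^2 * (T:ℝ) = ∑ s ∈ Finset.range T, ε^2 := by simp [mul_comm]
    rw [mistakesE, Finset.card_filter, Finset.card_filter, hT]
    push_cast
    rw [Finset.sum_mul, ← Finset.sum_sub_distrib, ← Finset.sum_sub_distrib,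
      ← Finset.sum_sub_distrib]
    apply Finset.sum_le_sum
    intro s _
    have := sq_nonneg ε
    cases predE n (lrnE n ε) P y s <;> cases y s <;> cases P s j <;> simp <;> linarith
  linarith

lemma upper_final (n T k : ℕ) (hT : 2 ≤ T) (hn : T ≤ n) :
    ∃ Lrn : ExpertLearner n, ∀ (P : ℕ → Fin n → Bool) (y : ℕ → Bool),
          (∃ j : Fin n, ((Finset.range T).filter (fun t => P t j ≠ y t)).card ≤ k) →
          (mistakesE n Lrn P y T : ℝ) ≤ 4 * Real.sqrt (T * (k + Real.log n)) := by
  have hT0 : (0:ℝ) < T := by exact_mod_cast (by omega : 0 < T)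
  have hl : 0 < Real.log n := Real.log_pos (by exact_mod_cast (by omega : 1 < n))
  have hk : (0:ℝ) ≤ k := Nat.cast_nonneg k
  set D : ℝ := k + Real.log n with hD
  have hD0 : 0 < D := by linarith
  rcases le_or_gt (T:ℝ) D with hc | hc
  · refine ⟨fun _ _ => true, fun P y _ => ?_⟩
    have h1 : (mistakesE n (fun _ _ => true) P y T : ℝ) ≤ T := by
      have : mistakesE n (fun _ _ => true) P y T ≤ T := by
        unfold mistakesE
        simpa using (Finset.card_filter_le (Finset.range T) _)
      exact_mod_cast this
    have h2 : (T:ℝ) ≤ Real.sqrt (T * D) := Real.le_sqrt_of_sq_le (by nlinarith)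
    linarith
  · set ε := Real.sqrt (D / T) with hε
    have hε2 : ε^2 = D / T := Real.sq_sqrt (by positivity)
    have hε0 : 0 < ε := Real.sqrt_pos.mpr (by positivity)
    have hε1 : ε ≤ 1 := Real.sqrt_le_one.mpr ((div_le_one hT0).mpr hc.le)
    have hs : Real.sqrt (T * D) = ε * T := by
      have : (T:ℝ) * D = (ε * T)^2 := by
        rw [mul_pow, hε2]; field_simp
      rw [this, Real.sqrt_sq (by positivity)]
    refine ⟨lrnE n ε, fun P y ⟨j, hj⟩ => ?_⟩
    have h := upper_main n (by omega) ε hε0.le hε1 P y j T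
    have hj' : (((Finset.range T).filter (fun t => P t j ≠ y t)).card : ℝ) ≤ k := by
      exact_mod_cast hj
    have h7 : ε^2 * T = D := by rw [hε2]; field_simp
    rw [hs]
    have h8 : (mistakesE n (lrnE n ε) P y T : ℝ) * (ε/2) ≤ (4 * (ε * T)) * (ε/2) := by
      nlinarith
    exact le_of_mul_le_mul_right h8 (by positivity)

/-! ### Lower bound -/

/-- Prediction when all labels are `false`. -/
def pred0 (n : ℕ) (L : ExpertLearner n) (P : ℕ → Fin n → Bool) (t : ℕ) : Bool :=
  predE n L P (fun _ => false) t

lemma histE_congr (n : ℕ) (L : ExpertLearner n) (P P' : ℕ → Fin n → Bool) (y : ℕ → Bool) (t : ℕ)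
    (h : ∀ s < t, P s = P' s) : histE n L P y t = histE n L P' y t := by
  induction t with
  | zero => rfl
  | succ t ih =>
    have ih' := ih (fun s hs => h s (by omega))
    simp only [histE]
    rw [ih', h t (by omega)]

lemma pred0_congr (n : ℕ) (L : ExpertLearner n) (P P' : ℕ → Fin n → Bool) (t : ℕ)
    (h : ∀ s ≤ t, P s = P' s) : pred0 n L P t = pred0 n L P' t := by
  unfold pred0 predE
  rw [histE_congr n L P P' _ t (fun s hs => h s hs.le), h t le_rfl]

lemma histE_false (n : ℕ) (L : ExpertLearner n) (P : ℕ → Fin n → Bool) (y : ℕ → Bool) (t : ℕ)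
    (h : ∀ s, pred0 n L P s = true → y s = false) :
    histE n L P y t = histE n L P (fun _ => false) t := by
  induction t with
  | zero => rfl
  | succ t ih =>
    simp only [histE]
    rw [ih]
    have := h t
    simp only [pred0, predE] at this
    by_cases hc : L (histE n L P (fun _ => false) t) (P t) = true
    · simp [hc, this hc]
    · simp [hc]

/-- Number of `1`-predictions. -/
def FE (n : ℕ) (L : ExpertLearner n) (P : ℕ → Fin n → Bool) (t : ℕ) : ℕ :=
  ((Finset.range t).filter (fun s => pred0 n L P s = true)).card

/-- Number of rounds where the learner says `0` and expert `j` says `1`. -/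
def aE (n : ℕ) (L : ExpertLearner n) (P : ℕ → Fin n → Bool) (t : ℕ) (j : Fin n) : ℕ :=
  ((Finset.range t).filter (fun s => pred0 n L P s = false ∧ P s j = true)).card

/-- Number of rounds where the learner says `1` and expert `j` says `1`. -/
def bE (n : ℕ) (L : ExpertLearner n) (P : ℕ → Fin n → Bool) (t : ℕ) (j : Fin n) : ℕ :=
  ((Finset.range t).filter (fun s => pred0 n L P s = true ∧ P s j = true)).card

lemma adv (n : ℕ) (L : ExpertLearner n) (P : ℕ → Fin n → Bool) (T : ℕ) (j : Fin n) :
    ∃ y : ℕ → Bool, ((Finset.range T).filter (fun t => P t j ≠ y t)).card = bE n L P T j ∧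
      mistakesE n L P y T = FE n L P T + aE n L P T j := by
  refine ⟨fun t => !(pred0 n L P t) && P t j, ?_, ?_⟩
  · unfold bE
    congr 1
    apply Finset.filter_congr
    intro t _
    cases h1 : pred0 n L P t <;> cases h2 : P t j <;> simp [h1, h2]
  · have hp : ∀ t, predE n L P (fun t => !(pred0 n L P t) && P t j) t = pred0 n L P t := by
      intro t
      unfold predE
      rw [histE_false]
      · rfl
      · intro s hs; simp [hs]
    unfold mistakesE FE aE
    simp only [hp]
    rw [← Finset.card_union_of_disjoint]
    · congr 1
      ext t
      simp only [Finset.mem_filter, Finset.mem_union]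
      cases pred0 n L P t <;> cases P t j <;> simp
    · rw [Finset.disjoint_left]
      intro t ht ht'
      simp only [Finset.mem_filter] at ht ht'
      rw [ht.2] at ht'
      simp at ht'

lemma low_avg {ι : Type*} [DecidableEq ι] (V : Finset ι) (a : ι → ℝ) (d : ℕ) (hd : d ≤ V.card) :
    ∃ A ⊆ V, A.card = V.card - d ∧ (∑ i ∈ A, a i) * V.card ≤ A.card * ∑ i ∈ V, a i := by
  induction d with
  | zero => exact ⟨V, subset_rfl, by simp, by rw [mul_comm]⟩
  | succ d ih =>
    obtain ⟨A, hAV, hc, hA⟩ := ih (by omega)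
    have hne : A.Nonempty := Finset.card_pos.mp (by omega)
    obtain ⟨x, hx, hmax⟩ := Finset.exists_max_image A a hne
    have hcard := Finset.card_erase_of_mem hx
    refine ⟨A.erase x, (Finset.erase_subset _ _).trans hAV, by omega, ?_⟩
    have hs : a x + ∑ i ∈ A.erase x, a i = ∑ i ∈ A, a i := Finset.add_sum_erase _ _ hx
    have hle : ∑ i ∈ A, a i ≤ A.card * a x := by
      have := Finset.sum_le_card_nsmul A a (a x) hmax
      simpa using this
    have hc1 : ((A.erase x).card : ℝ) = A.card - 1 := by
      rw [hcard, Nat.cast_sub (by omega)]; simp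
    have hc0 : (1:ℝ) ≤ A.card := by exact_mod_cast (by omega : 1 ≤ A.card)
    have hv : (0:ℝ) ≤ V.card := Nat.cast_nonneg _
    rw [hc1]
    have hs' : ∑ i ∈ A.erase x, a i = ∑ i ∈ A, a i - a x := by linarith
    rw [hs']
    set c : ℝ := (A.card : ℝ)
    set v : ℝ := (V.card : ℝ)
    set SA := ∑ i ∈ A, a i
    set S := ∑ i ∈ V, a i
    have h1 : c * ((SA - a x) * v) ≤ c * ((c - 1) * S) := by
      have h2 : c * (SA - a x) ≤ (c - 1) * SA := by linarith
      have h3 := mul_le_mul_of_nonneg_right h2 hv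
      have h4 := mul_le_mul_of_nonneg_left hA (by linarith : 0 ≤ c - 1)
      nlinarith
    exact le_of_mul_le_mul_left h1 (by linarith)

section
variable (n : ℕ) (Lrn : ExpertLearner n) (P : ℕ → Fin n → Bool) (t : ℕ) (p : Fin n → Bool)

lemma pred0_update_lt (s : ℕ) (hs : s < t) :
    pred0 n Lrn (Function.update P t p) s = pred0 n Lrn P s := by
  apply pred0_congr
  intro r hr
  rw [Function.update_of_ne (by omega)]

lemma FE_update : FE n Lrn (Function.update P t p) (t+1) =
    FE n Lrn P t + if pred0 n Lrn (Function.update P t p) t = true then 1 else 0 := by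
  unfold FE
  rw [Finset.card_filter, Finset.sum_range_succ, Finset.card_filter]
  congr 1
  apply Finset.sum_congr rfl
  intro s hs
  rw [pred0_update_lt n Lrn P t p s (Finset.mem_range.mp hs)]

lemma aE_update (j : Fin n) : aE n Lrn (Function.update P t p) (t+1) j =
    aE n Lrn P t j +
      if pred0 n Lrn (Function.update P t p) t = false ∧ p j = true then 1 else 0 := by
  unfold aE
  rw [Finset.card_filter, Finset.sum_range_succ, Finset.card_filter, Function.update_self]
  congr 1
  apply Finset.sum_congr rfl
  intro s hs
  have := Finset.mem_range.mp hs
  rw [pred0_update_lt n Lrn P t p s this, Function.update_of_ne (by omega)]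
end

lemma game (n L m : ℕ) (hL : 0 < L) (hm : (L:ℝ) ≤ n * (1 - 1/(L:ℝ))^m) (Lrn : ExpertLearner n)
    (t : ℕ) : ∃ (P : ℕ → Fin n → Bool) (V : Finset (Fin n)), V.Nonempty ∧
      (∀ j ∈ V, ∀ s < t, pred0 n Lrn P s = true → P s j = false) ∧
      (m ≤ FE n Lrn P t ∨ (FE n Lrn P t < m ∧ (n:ℝ) * (1 - 1/(L:ℝ))^(FE n Lrn P t) ≤ V.card ∧
        (V.card : ℝ) * ((t:ℝ) - FE n Lrn P t) ≤ 2 * L * ∑ j ∈ V, (aE n Lrn P t j : ℝ))) := by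
  have hL1 : (1:ℝ) ≤ L := by exact_mod_cast hL
  have hq0 : 0 ≤ 1 - 1/(L:ℝ) := by
    have : 1/(L:ℝ) ≤ 1 := (div_le_one (by linarith)).mpr hL1
    linarith
  have hq1 : 1 - 1/(L:ℝ) ≤ 1 := by
    have : 0 ≤ 1/(L:ℝ) := by positivity
    linarith
  have hbig : ∀ f ≤ m, (L:ℝ) ≤ n * (1 - 1/(L:ℝ))^f := fun f hf =>
    hm.trans (mul_le_mul_of_nonneg_left (pow_le_pow_of_le_one hq0 hq1 hf) (Nat.cast_nonneg n))
  induction t with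
  | zero =>
    refine ⟨fun _ _ => false, Finset.univ, ?_, by simp, ?_⟩
    · have := hbig 0 (by omega)
      have h2 : 0 < n := by
        simp at this; omega
      exact ⟨⟨0, h2⟩, Finset.mem_univ _⟩
    · rcases Nat.eq_zero_or_pos m with h | h
      · left; omega
      · right; simp [FE, aE, h]
  | succ t ih =>
    obtain ⟨P, V, hV, halive, hcase⟩ := ih
    rcases hcase with hF | ⟨hF, hcard, havg⟩
    · refine ⟨Function.update P t (fun _ => false), V, hV, ?_, Or.inl ?_⟩
      · intro j hj s hs
        rcases Nat.lt_succ_iff_lt_or_eq.mp hs with h | h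
        · rw [pred0_update_lt _ _ _ _ _ _ h, Function.update_of_ne (by omega)]
          exact halive j hj s h
        · subst h; simp
      · rw [FE_update]; omega
    · have hvL : (L:ℝ) ≤ V.card := (hbig _ hF.le).trans hcard
      have hvL' : L ≤ V.card := by exact_mod_cast hvL
      set s := V.card / L with hs
      have hs1 : 1 ≤ s := (Nat.one_le_div_iff hL).mpr hvL'
      have hsv : s * L ≤ V.card := Nat.div_mul_le_self _ _
      have hsv' : s ≤ V.card := Nat.div_le_self _ _
      have hvs : V.card ≤ 2 * L * s := by
        have h1 := Nat.div_add_mod V.card L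
        have h2 := Nat.mod_lt V.card hL
        rw [← hs] at h1
        nlinarith
      obtain ⟨A, hAV, hAc, hA⟩ := low_avg V (fun j => (aE n Lrn P t j : ℝ)) (V.card - s) (by omega)
      have hAs : A.card = s := by omega
      rw [hAs] at hA
      have hv0 : (0:ℝ) < V.card := by linarith
      have hsvR : (s:ℝ) * L ≤ V.card := by exact_mod_cast hsv
      have hvsR : (V.card:ℝ) ≤ 2 * L * s := by exact_mod_cast hvs
      set p : Fin n → Bool := fun j => decide (j ∈ A) with hp
      cases hpred : pred0 n Lrn (Function.update P t p) t
      · refine ⟨Function.update P t p, V, hV, ?_, Or.inr ?_⟩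
        · intro j hj r hr
          rcases Nat.lt_succ_iff_lt_or_eq.mp hr with h | h
          · rw [pred0_update_lt _ _ _ _ _ _ h, Function.update_of_ne (by omega)]
            exact halive j hj r h
          · subst h; simp [hpred]
        · have hFE : FE n Lrn (Function.update P t p) (t+1) = FE n Lrn P t := by
            rw [FE_update]; simp [hpred]
          rw [hFE]
          refine ⟨hF, hcard, ?_⟩
          have hsum : ∑ j ∈ V, (aE n Lrn (Function.update P t p) (t+1) j : ℝ)
              = ∑ j ∈ V, (aE n Lrn P t j : ℝ) + s := by
            simp_rw [aE_update]
            push_cast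
            rw [Finset.sum_add_distrib]
            congr 1
            simp only [hpred, true_and]
            simp only [hp, decide_eq_true_eq]
            rw [Finset.sum_ite_mem, Finset.inter_eq_right.mpr hAV]
            simp [hAs]
          rw [hsum]
          push_cast
          nlinarith
      · have hcd : (V \ A).card = V.card - s := by
          rw [Finset.card_sdiff_of_subset hAV, hAs]
        have hcdR : ((V \ A).card : ℝ) = V.card - s := by
          rw [hcd, Nat.cast_sub hsv']
        have hFE : FE n Lrn (Function.update P t p) (t+1) = FE n Lrn P t + 1 := by
          rw [FE_update]; simp [hpred]
        have hnew : (n:ℝ) * (1 - 1/(L:ℝ))^(FE n Lrn P t + 1) ≤ (V \ A).card := by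
          rw [hcdR, pow_succ, ← mul_assoc]
          have h1 := mul_le_mul_of_nonneg_right hcard hq0
          have h2 : (s:ℝ) ≤ V.card * (1/(L:ℝ)) := by
            rw [mul_one_div, le_div_iff₀ (by linarith)]; exact hsvR
          linarith
        refine ⟨Function.update P t p, V \ A, ?_, ?_, ?_⟩
        · have h1 := hbig (FE n Lrn P t + 1) (by omega)
          have h2 : (0:ℝ) < (V \ A).card := by linarith
          exact Finset.card_pos.mp (by exact_mod_cast h2)
        · intro j hj r hr
          rw [Finset.mem_sdiff] at hj
          rcases Nat.lt_succ_iff_lt_or_eq.mp hr with h | h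
          · rw [pred0_update_lt _ _ _ _ _ _ h, Function.update_of_ne (by omega)]
            exact halive j hj.1 r h
          · subst h; simp [hp, hj.2]
        · rw [hFE]
          rcases Nat.lt_or_ge (FE n Lrn P t + 1) m with h | h
          · refine Or.inr ⟨h, hnew, ?_⟩
            have hsum : ∑ j ∈ V \ A, (aE n Lrn (Function.update P t p) (t+1) j : ℝ)
              = ∑ j ∈ V, (aE n Lrn P t j : ℝ) - ∑ j ∈ A, (aE n Lrn P t j : ℝ) := by
              simp_rw [aE_update]
              simp only [hpred]
              simp
              rw [← Finset.sum_sdiff hAV]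
              ring
            rw [hsum, hcdR]
            push_cast
            set S := ∑ j ∈ V, (aE n Lrn P t j : ℝ)
            set SA := ∑ j ∈ A, (aE n Lrn P t j : ℝ)
            set v : ℝ := (V.card : ℝ)
            set f : ℝ := (FE n Lrn P t : ℝ)
            have hvs0 : 0 ≤ v - s := by
              have : (s:ℝ) ≤ V.card := by exact_mod_cast hsv'
              linarith
            have h1 := mul_le_mul_of_nonneg_right havg hvs0
            have h2 := mul_le_mul_of_nonneg_left hA (by positivity : (0:ℝ) ≤ 2 * L)
            have h3 : v * ((v - s) * (t + 1 - (f + 1))) ≤ v * (2 * L * (S - SA)) := by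
              nlinarith
            exact le_of_mul_le_mul_left h3 hv0
          · exact Or.inl h

lemma game_final (n L m T : ℕ) (hL : 0 < L) (hm : (L:ℝ) ≤ n * (1 - 1/(L:ℝ))^m)
    (Lrn : ExpertLearner n) : ∃ (P : ℕ → Fin n → Bool) (y : ℕ → Bool),
      (∃ j : Fin n, ((Finset.range T).filter (fun t => P t j ≠ y t)).card = 0) ∧
      (m ≤ mistakesE n Lrn P y T ∨ ((T:ℝ) - m) / (2 * L) ≤ mistakesE n Lrn P y T) := by
  obtain ⟨P, V, hV, halive, hcase⟩ := game n L m hL hm Lrn T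
  have hb : ∀ j ∈ V, bE n Lrn P T j = 0 := by
    intro j hj
    unfold bE
    rw [Finset.card_eq_zero, Finset.filter_eq_empty_iff]
    rintro s hs ⟨h1, h2⟩
    rw [halive j hj s (Finset.mem_range.mp hs) h1] at h2
    simp at h2
  rcases hcase with hF | ⟨hF, hcard, havg⟩
  · obtain ⟨j, hj⟩ := hV
    obtain ⟨y, h1, h2⟩ := adv n Lrn P T j
    exact ⟨P, y, ⟨j, by rw [h1, hb j hj]⟩, Or.inl (by omega)⟩
  · have : ∃ j ∈ V, ((T:ℝ) - FE n Lrn P T) / (2 * L) ≤ aE n Lrn P T j := by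
      apply Finset.exists_le_of_sum_le hV
      rw [Finset.sum_const, nsmul_eq_mul, ← mul_div_assoc, div_le_iff₀ (by positivity)]
      linarith
    obtain ⟨j, hj, hja⟩ := this
    obtain ⟨y, h1, h2⟩ := adv n Lrn P T j
    refine ⟨P, y, ⟨j, by rw [h1, hb j hj]⟩, Or.inr ?_⟩
    rw [h2]
    have hF' : (FE n Lrn P T : ℝ) ≤ m := by exact_mod_cast hF.le
    have h3 : ((T:ℝ) - m) / (2 * L) ≤ ((T:ℝ) - FE n Lrn P T) / (2 * L) := by
      gcongr
    push_cast
    have : (0:ℝ) ≤ FE n Lrn P T := Nat.cast_nonneg _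
    linarith

set_option maxHeartbeats 1000000 in
lemma lower_log (n T : ℕ) (hT : 2 ≤ T) (hn : T ≤ n) (hlt : (n : ℝ) < 2 ^ ((T : ℝ) / 2))
    (Lrn : ExpertLearner n) : ∃ (P : ℕ → Fin n → Bool) (y : ℕ → Bool),
      (∃ j : Fin n, ((Finset.range T).filter (fun t => P t j ≠ y t)).card = 0) ∧
      Real.sqrt (T * Real.log n) / 64 ≤ mistakesE n Lrn P y T := by
  have hsqR : (n:ℝ)^2 < 2^T := by
    have h1 : ((2:ℝ) ^ ((T : ℝ) / 2))^2 = 2^T := by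
      rw [← Real.rpow_natCast, ← Real.rpow_mul (by norm_num), ← Real.rpow_natCast]
      congr 1
      push_cast; ring
    rw [← h1]
    exact pow_lt_pow_left₀ hlt (Nat.cast_nonneg n) (by norm_num)
  have hsq : n^2 < 2^T := by exact_mod_cast hsqR
  have hT5 : 5 ≤ T := by
    by_contra h
    push Not at h
    have : T = 2 ∨ T = 3 ∨ T = 4 := by omega
    rcases this with rfl | rfl | rfl <;> nlinarith
  have hn5 : 5 ≤ n := hT5.trans hn
  have hn5R : (5:ℝ) ≤ n := by exact_mod_cast hn5
  have hT5R : (5:ℝ) ≤ T := by exact_mod_cast hT5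
  have hnTR : (T:ℝ) ≤ n := by exact_mod_cast hn
  set l := Real.log n with hl
  have hlog2 := Real.log_two_lt_d9
  have hlog2' := Real.log_two_gt_d9
  have hlT : l ≤ 0.35 * T := by
    have h1 : Real.log ((n:ℝ)^2) < Real.log (2^T) := Real.log_lt_log (by positivity) hsqR
    rw [Real.log_pow, Real.log_pow] at h1
    push_cast at h1
    nlinarith
  have hl1 : 1.38 ≤ l := by
    have h1 : Real.log ((2:ℝ)^2) ≤ Real.log n := Real.log_le_log (by norm_num) (by linarith)
    rw [Real.log_pow] at h1
    push_cast at h1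
    linarith
  have hexp : Real.exp l = n := Real.exp_log (by linarith)
  clear_value l
  set x := Real.sqrt (T / l) with hx
  have hx2 : x^2 = T / l := Real.sq_sqrt (by positivity)
  have hx2' : x^2 * l = T := by rw [hx2]; field_simp
  have hx0 : 0 ≤ x := Real.sqrt_nonneg _
  have hx1 : 1 < x := by
    rw [hx, Real.lt_sqrt (by norm_num), lt_div_iff₀ (by linarith)]; linarith
  have hs : Real.sqrt (T * l) = x * l := by
    have : (T:ℝ) * l = (x * l)^2 := by rw [← hx2']; ring
    rw [this, Real.sqrt_sq (by positivity)]
  rw [hs]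
  set L := ⌈x⌉₊ with hL
  have hxL : x ≤ L := Nat.le_ceil x
  have hLx : (L:ℝ) ≤ 2 * x := by
    have := Nat.ceil_lt_add_one hx0
    linarith
  have hL2 : 2 ≤ L := by
    have : (1:ℝ) < L := by linarith
    have : 1 < L := by exact_mod_cast this
    omega
  have hL2R : (2:ℝ) ≤ L := by exact_mod_cast hL2
  clear_value L
  rcases le_or_gt ((L:ℝ) * l) 32 with hc | hc
  · obtain ⟨P, y, hj, hM⟩ := game_final n 2 1 T (by norm_num) (by norm_num; linarith) Lrn
    refine ⟨P, y, hj, ?_⟩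
    have hM1 : (1:ℝ) ≤ mistakesE n Lrn P y T := by
      rcases hM with h | h
      · exact_mod_cast h
      · norm_num at h; linarith
    nlinarith
  · have hxl : 16 ≤ x * l := by nlinarith
    have hT9 : (9:ℝ) ≤ T := by
      have h1 : (x*l)^2 = T * l := by rw [← hx2']; ring
      nlinarith
    set m := ⌊(L:ℝ) * l / 32⌋₊ with hmdef
    have hmle : (m:ℝ) ≤ L * l / 32 := Nat.floor_le (by positivity)
    have hmge : (L:ℝ) * l / 64 ≤ m := by
      have h1 := Nat.lt_floor_add_one ((L:ℝ) * l / 32)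
      rw [← hmdef] at h1
      have h2 : 1 ≤ m := by
        rw [hmdef, Nat.one_le_floor_iff]; linarith
      have h3 : (1:ℝ) ≤ m := by exact_mod_cast h2
      linarith
    clear_value m
    have hm : (L:ℝ) ≤ n * (1 - 1/(L:ℝ))^m := by
      have hL0 : (0:ℝ) < L := by linarith
      have h1 : Real.exp (-(2/(L:ℝ))) ≤ 1 - 1/(L:ℝ) := by
        have h2 : (2:ℝ)/L + 1 ≤ Real.exp (2/(L:ℝ)) := Real.add_one_le_exp _
        rw [Real.exp_neg]
        rw [inv_le_comm₀ (Real.exp_pos _)]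
        · refine le_trans ?_ h2
          rw [inv_le_iff_one_le_mul₀]
          · have h4 : 1/(L:ℝ) ≤ 1/2 := one_div_le_one_div_of_le (by norm_num) hL2R
            have h5 : (2:ℝ)/L = 2 * (1/L) := by ring
            have h6 : 0 < 1/(L:ℝ) := by positivity
            rw [h5]
            nlinarith
          · have h4 : 1/(L:ℝ) ≤ 1/2 := one_div_le_one_div_of_le (by norm_num) hL2R
            linarith
        · have h4 : 1/(L:ℝ) ≤ 1/2 := one_div_le_one_div_of_le (by norm_num) hL2R
          linarith
      have h2 : Real.exp (-(l/16)) ≤ (1 - 1/(L:ℝ))^m := by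
        refine le_trans ?_ (pow_le_pow_left₀ (Real.exp_pos _).le h1 m)
        rw [← Real.exp_nat_mul, Real.exp_le_exp]
        have : (m:ℝ) * (2/L) ≤ l/16 := by
          rw [← mul_div_assoc, div_le_iff₀ hL0]; linarith
        linarith
      have h3 : (L:ℝ) ≤ Real.exp (3/4*l) := by
        have hr2 : Real.exp (l/2) ^ 2 = n := by
          rw [← Real.exp_nat_mul, ← hexp]; congr 1; push_cast; ring
        have hr3 : Real.exp (3/4*l) ^ 2 = Real.exp (l/2) ^ 3 := by
          rw [← Real.exp_nat_mul, ← Real.exp_nat_mul]; congr 1; push_cast; ring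
        have hr0 := Real.exp_pos (l/2)
        have hr : 3 ≤ Real.exp (l/2) := by
          refine (sq_le_sq₀ (by norm_num) hr0.le).mp ?_
          rw [hr2]; linarith
        refine (sq_le_sq₀ (by linarith) (Real.exp_pos _).le).mp ?_
        rw [hr3]
        have h5 : x^2 * 1.38 ≤ n := by 
          calc x^2 * 1.38 ≤ x^2 * l := mul_le_mul_of_nonneg_left hl1 (sq_nonneg x)
            _ = T := hx2'
            _ ≤ n := hnTR
        have h6 : (L:ℝ)^2 ≤ 4 * x^2 := by
          calc (L:ℝ)^2 ≤ (2 * x)^2 := pow_le_pow_left₀ hL0.le hLx 2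
            _ = 4 * x^2 := by ring
        have h7 : Real.exp (l/2) ^ 3 = Real.exp (l/2) * n := by rw [← hr2]; ring
        rw [h7]
        have h8 : 3 * (n:ℝ) ≤ Real.exp (l/2) * n := mul_le_mul_of_nonneg_right hr (by linarith)
        linarith
      calc (L:ℝ) ≤ Real.exp (3/4*l) := h3
        _ ≤ Real.exp (l + -(l/16)) := by rw [Real.exp_le_exp]; linarith
        _ = n * Real.exp (-(l/16)) := by rw [Real.exp_add, hexp]
        _ ≤ _ := mul_le_mul_of_nonneg_left h2 (by linarith)
    obtain ⟨P, y, hj, hM⟩ := game_final n L m T (by omega) hm Lrn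
    refine ⟨P, y, hj, ?_⟩
    rcases hM with h | h
    · have h' : (m:ℝ) ≤ mistakesE n Lrn P y T := by exact_mod_cast h
      nlinarith
    · refine le_trans ?_ h
      rw [le_div_iff₀ (by linarith)]
      have h1 : (m:ℝ) ≤ T / 2 := by
        have : x * l ≤ x^2 * l := by nlinarith
        nlinarith
      have h2 : x * l / 64 * (2 * L) ≤ x * l / 64 * (2 * (2 * x)) := by gcongr
      nlinarith

lemma lower_k (n T k : ℕ) (hT : 2 ≤ T) (hk : 1 ≤ k) (hkT : k ≤ T) (hn : T ≤ n)
    (Lrn : ExpertLearner n) : ∃ (P : ℕ → Fin n → Bool) (y : ℕ → Bool),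
      (∃ j : Fin n, ((Finset.range T).filter (fun t => P t j ≠ y t)).card ≤ k) ∧
      Real.sqrt (T * k) / 2 ≤ mistakesE n Lrn P y T := by
  have hkR : (1:ℝ) ≤ k := by exact_mod_cast hk
  have hkTR : (k:ℝ) ≤ T := by exact_mod_cast hkT
  have hTR : (2:ℝ) ≤ T := by exact_mod_cast hT
  set x := Real.sqrt (T / k) with hx
  have hx2 : x^2 = T / k := Real.sq_sqrt (by positivity)
  have hx2' : x^2 * k = T := by rw [hx2]; field_simp
  have hx0 : 0 ≤ x := Real.sqrt_nonneg _
  have hx1 : 1 ≤ x := by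
    rw [hx, Real.le_sqrt' (by norm_num), le_div_iff₀ (by linarith)]; linarith
  have hs : Real.sqrt (T * k) = x * k := by
    have : (T:ℝ) * k = (x * k)^2 := by rw [← hx2']; ring
    rw [this, Real.sqrt_sq (by positivity)]
  rw [hs]
  set L := ⌊x⌋₊ with hL
  have hLx : (L:ℝ) ≤ x := Nat.floor_le hx0
  have hL1 : 1 ≤ L := by rw [hL, Nat.one_le_floor_iff]; exact hx1
  have hL1R : (1:ℝ) ≤ L := by exact_mod_cast hL1
  have hxL : x ≤ 2 * L := by
    have := Nat.lt_floor_add_one x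
    rw [← hL] at this
    linarith
  clear_value L
  have hLT : L < T := by
    have h1 : x^2 ≤ T := by nlinarith
    have h2 : (L:ℝ) < T := by
      by_contra h
      push Not at h
      nlinarith
    exact_mod_cast h2
  set P : ℕ → Fin n → Bool := fun t j => decide (t % L = j.val) with hP
  rcases Nat.lt_or_ge (L * k) (FE n Lrn P T) with hF | hF
  · obtain ⟨y, h1, h2⟩ := adv n Lrn P T ⟨L, by omega⟩
    refine ⟨P, y, ⟨⟨L, by omega⟩, ?_⟩, ?_⟩
    · rw [h1]
      unfold bE
      rw [Finset.filter_eq_empty_iff.mpr]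
      · simp
      · rintro s _ ⟨_, h3⟩
        have := Nat.mod_lt s hL1
        simp [hP] at h3
        omega
    · rw [h2]
      have hF' : (L:ℝ) * k ≤ FE n Lrn P T := by exact_mod_cast hF.le
      push_cast
      have : (0:ℝ) ≤ aE n Lrn P T ⟨L, by omega⟩ := Nat.cast_nonneg _
      nlinarith
  · have hsum : ∑ i ∈ Finset.range L,
        (((Finset.range T).filter (fun s => pred0 n Lrn P s = true)).filter
          (fun s => s % L = i)).card = FE n Lrn P T := by
      unfold FE
      rw [← Finset.card_eq_sum_card_fiberwise]
      intro s _
      simpa using Nat.mod_lt s hL1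
    have hex : ∃ i ∈ Finset.range L, (((Finset.range T).filter (fun s => pred0 n Lrn P s = true)).filter
          (fun s => s % L = i)).card ≤ k := by
      apply Finset.exists_le_of_sum_le ⟨0, Finset.mem_range.mpr hL1⟩
      rw [hsum]
      simpa using hF
    obtain ⟨i, hi, hik⟩ := hex
    rw [Finset.mem_range] at hi
    set j : Fin n := ⟨i, by omega⟩ with hj
    have hb : bE n Lrn P T j ≤ k := by
      rw [Finset.filter_filter] at hik
      simpa [bE, hP, hj] using hik
    have hcalls : T / L ≤ aE n Lrn P T j + bE n Lrn P T j := by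
      have h1 : aE n Lrn P T j + bE n Lrn P T j
          = ((Finset.range T).filter (fun s => s % L = i)).card := by
        unfold aE bE
        rw [← Finset.card_union_of_disjoint]
        · congr 1
          ext t
          simp only [Finset.mem_filter, Finset.mem_union, hP, hj, decide_eq_true_eq]
          cases pred0 n Lrn P t <;> simp
        · rw [Finset.disjoint_left]
          intro t ht ht'
          simp only [Finset.mem_filter] at ht ht'
          rw [ht.2.1] at ht'
          simp at ht'
      rw [h1]
      have h2 : (Finset.range (T / L)).card ≤
          ((Finset.range T).filter (fun s => s % L = i)).card := by
        apply Finset.card_le_card_of_injOn (fun q => q * L + i)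
        · intro q hq
          simp only [Finset.coe_range, Set.mem_Iio] at hq
          simp only [Finset.coe_filter, Finset.mem_range, Set.mem_ofPred_eq]
          constructor
          · have h3 := Nat.div_mul_le_self T L
            nlinarith
          · rw [Nat.add_comm, Nat.add_mul_mod_self_right, Nat.mod_eq_of_lt hi]
        · intro q _ q' _ h
          simp only [add_left_inj] at h
          exact Nat.eq_of_mul_eq_mul_right hL1 h
      simpa using h2
    have hbF : bE n Lrn P T j ≤ FE n Lrn P T := by
      unfold bE FE
      apply Finset.card_le_card
      intro s hs
      simp only [Finset.mem_filter] at hs ⊢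
      exact ⟨hs.1, hs.2.1⟩
    obtain ⟨y, h1, h2⟩ := adv n Lrn P T j
    refine ⟨P, y, ⟨j, by rw [h1]; exact hb⟩, ?_⟩
    have hM : T / L ≤ mistakesE n Lrn P y T := by omega
    have hMR : ((T / L : ℕ) : ℝ) ≤ mistakesE n Lrn P y T := by exact_mod_cast hM
    refine le_trans ?_ hMR
    have h5 : T ≤ 2 * L * (T / L) := by
      have h1 := Nat.div_add_mod T L
      have h2 := Nat.mod_lt T hL1
      have h3 : 1 ≤ T / L := (Nat.one_le_div_iff hL1).mpr hLT.le
      nlinarith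
    have h6 : (T:ℝ) ≤ 2 * L * ((T / L : ℕ) : ℝ) := by exact_mod_cast h5
    have h7 : (0:ℝ) ≤ ((T / L : ℕ) : ℝ) := Nat.cast_nonneg _
    have h8 : x * (x * k / 2) ≤ x * ((T / L : ℕ) : ℝ) := by nlinarith
    exact le_of_mul_le_mul_left h8 (by linarith)

/-- Optimal deterministic mistake bound for prediction with expert advice under apple
tasting feedback: for all `k ≤ T ≤ n < 2^{T/2}` with `T ≥ 2`,
`M*(n,T,k) = Θ(√(T(k + log n)))`: some deterministic learner achieves
`C·√(T(k + log n))` on every `k`-realizable sequence, and every deterministic learner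
is forced to make at least `c·√(T(k + log n))` mistakes on some `k`-realizable sequence. -/
theorem experts_agnostic_optimal :
    ∃ c C : ℝ, 0 < c ∧ 0 < C ∧
      ∀ n T k : ℕ, 2 ≤ T → k ≤ T → T ≤ n → (n : ℝ) < 2 ^ ((T : ℝ) / 2) →
        (∃ Lrn : ExpertLearner n, ∀ (P : ℕ → Fin n → Bool) (y : ℕ → Bool),
          (∃ j : Fin n, ((Finset.range T).filter (fun t => P t j ≠ y t)).card ≤ k) →
          (mistakesE n Lrn P y T : ℝ) ≤ C * Real.sqrt (T * (k + Real.log n))) ∧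
        (∀ Lrn : ExpertLearner n, ∃ (P : ℕ → Fin n → Bool) (y : ℕ → Bool),
          (∃ j : Fin n, ((Finset.range T).filter (fun t => P t j ≠ y t)).card ≤ k) ∧
          c * Real.sqrt (T * (k + Real.log n)) ≤ (mistakesE n Lrn P y T : ℝ)) := by
  refine ⟨1/128, 4, by norm_num, by norm_num, fun n T k hT hkT hn hlt => ⟨?_, fun Lrn => ?_⟩⟩
  · exact upper_final n T k hT hn
  · have hl : 0 < Real.log n := Real.log_pos (by exact_mod_cast (by omega : 1 < n))
    have hT0 : (0:ℝ) ≤ T := Nat.cast_nonneg T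
    have key : ∀ z : ℝ, (k:ℝ) + Real.log n ≤ 2 * z →
        Real.sqrt (T * (k + Real.log n)) ≤ 2 * Real.sqrt (T * z) := by
      intro z hz
      have h4 : 2 * Real.sqrt (T * z) = Real.sqrt (4 * (T * z)) := by
        rw [Real.sqrt_mul (by norm_num : (0:ℝ) ≤ 4)]
        congr 1
        rw [show (4:ℝ) = 2^2 by norm_num, Real.sqrt_sq (by norm_num)]
      rw [h4]
      apply Real.sqrt_le_sqrt
      have hk0 : (0:ℝ) ≤ k := Nat.cast_nonneg k
      nlinarith
    rcases le_or_gt (Real.log n) k with hc | hc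
    · have hk : 1 ≤ k := by
        have : (0:ℝ) < k := by linarith
        have : 0 < k := by exact_mod_cast this
        omega
      obtain ⟨P, y, hj, hM⟩ := lower_k n T k hT hk hkT hn Lrn
      refine ⟨P, y, hj, ?_⟩
      have := key k (by linarith)
      have := Real.sqrt_nonneg ((T:ℝ) * k)
      linarith
    · obtain ⟨P, y, ⟨j, hj⟩, hM⟩ := lower_log n T hT hn hlt Lrn
      refine ⟨P, y, ⟨j, by omega⟩, ?_⟩
      have := key (Real.log n) (by linarith)
      linarith
end

section
/- For every natural d larger than some universal constant there exists a hypothesis class H with L(H) = O(d) and a threshold T₀(d) such that for all T ≥ T₀(d), every deterministic apple tasting learner makes Ω(√(dT log T)) mistakes on some realizable sequence of length T, i.e., M*(H,T) = Ω(√(dT log T)). -/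
/-- Littlestone shattering of a perfect binary mistake tree of depth `d`. -/
inductive Shatters {X : Type*} : Set (X → Bool) → ℕ → Prop
  | zero (H : Set (X → Bool)) (hne : H.Nonempty) : Shatters H 0
  | succ (H : Set (X → Bool)) (d : ℕ) (x : X)
      (h0 : Shatters {h ∈ H | h x = false} d)
      (h1 : Shatters {h ∈ H | h x = true} d) : Shatters H (d + 1)

/-- A deterministic apple tasting learner for a hypothesis class: it maps the feedback
history (instances together with the revealed label when the learner predicted `1`)
and the current instance to a prediction. -/
def ConceptLearner (X : Type) : Type := List (X × Option Bool) → X → Bool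

/-- The feedback history produced by running learner `Lrn` on instances `x` and true
labels `y` under apple tasting feedback. -/
def histC (X : Type) (Lrn : ConceptLearner X) (x : ℕ → X) (y : ℕ → Bool) :
    ℕ → List (X × Option Bool)
  | 0 => []
  | t + 1 =>
      histC X Lrn x y t ++
        [(x t, if Lrn (histC X Lrn x y t) (x t) = true then some (y t) else none)]

/-- The learner's prediction in round `t`. -/
def predC (X : Type) (Lrn : ConceptLearner X) (x : ℕ → X) (y : ℕ → Bool) (t : ℕ) : Bool :=
  Lrn (histC X Lrn x y t) (x t)

/-- The number of mistakes made by the learner during the first `T` rounds. -/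
def mistakesC (X : Type) (Lrn : ConceptLearner X) (x : ℕ → X) (y : ℕ → Bool) (T : ℕ) : ℕ :=
  ((Finset.range T).filter (fun t => predC X Lrn x y t ≠ y t)).card

/-! ### Running a learner on a finite list of instances -/

/-- Mistakes made by the learner on `xs` labelled by `f`, started from history `h0`. -/
def runMist {X : Type} (Lrn : ConceptLearner X) (f : X → Bool) :
    List (X × Option Bool) → List X → ℕ
  | _, [] => 0
  | h0, x :: xs => (if Lrn h0 x ≠ f x then 1 else 0) +
      runMist Lrn f (h0 ++ [(x, if Lrn h0 x = true then some (f x) else none)]) xs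

/-- Final history of the run. -/
def runHist {X : Type} (Lrn : ConceptLearner X) (f : X → Bool) :
    List (X × Option Bool) → List X → List (X × Option Bool)
  | h0, [] => h0
  | h0, x :: xs =>
      runHist Lrn f (h0 ++ [(x, if Lrn h0 x = true then some (f x) else none)]) xs

theorem runMist_append {X : Type} (Lrn : ConceptLearner X) (f : X → Bool) (xs ys : List X) :
    ∀ h0, runMist Lrn f h0 (xs ++ ys) =
      runMist Lrn f h0 xs + runMist Lrn f (runHist Lrn f h0 xs) ys := by
  induction xs with
  | nil => intro h0; simp [runMist, runHist]
  | cons x xs ih => intro h0; simp only [List.cons_append, runMist, runHist, ih]; ring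

theorem runHist_append {X : Type} (Lrn : ConceptLearner X) (f : X → Bool) (xs ys : List X) :
    ∀ h0, runHist Lrn f h0 (xs ++ ys) = runHist Lrn f (runHist Lrn f h0 xs) ys := by
  induction xs with
  | nil => intro h0; simp [runHist]
  | cons x xs ih => intro h0; simp only [List.cons_append, runHist, ih]

theorem runMist_congr {X : Type} (Lrn : ConceptLearner X) (f g : X → Bool) (xs : List X) :
    ∀ h0, (∀ x ∈ xs, f x = g x) → runMist Lrn f h0 xs = runMist Lrn g h0 xs := by
  induction xs with
  | nil => intro h0 _; simp [runMist]
  | cons x xs ih =>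
    intro h0 h
    have hx := h x (by simp)
    simp only [runMist, hx]
    rw [ih _ (fun z hz => h z (by simp [hz]))]

theorem runHist_congr {X : Type} (Lrn : ConceptLearner X) (f g : X → Bool) (xs : List X) :
    ∀ h0, (∀ x ∈ xs, f x = g x) → runHist Lrn f h0 xs = runHist Lrn g h0 xs := by
  induction xs with
  | nil => intro h0 _; simp [runHist]
  | cons x xs ih =>
    intro h0 h
    have hx := h x (by simp)
    simp only [runHist, hx]
    rw [ih _ (fun z hz => h z (by simp [hz]))]

theorem histC_eq {X : Type} (Lrn : ConceptLearner X) (f : X → Bool) (x : ℕ → X) (T : ℕ) :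
    histC X Lrn x (fun t => f (x t)) T = runHist Lrn f [] ((List.range T).map x) := by
  induction T with
  | zero => simp [histC, runHist]
  | succ T ih =>
    rw [List.range_succ, List.map_append, runHist_append, ← ih]
    simp [histC, runHist]

theorem mistakesC_eq {X : Type} (Lrn : ConceptLearner X) (f : X → Bool) (x : ℕ → X) (T : ℕ) :
    mistakesC X Lrn x (fun t => f (x t)) T = runMist Lrn f [] ((List.range T).map x) := by
  induction T with
  | zero => simp [mistakesC, runMist]
  | succ T ih =>
    rw [List.range_succ, List.map_append, runMist_append, ← ih, ← histC_eq]
    have e : runMist Lrn f (histC X Lrn x (fun t => f (x t)) T) (List.map x [T]) =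
        if predC X Lrn x (fun t => f (x t)) T ≠ f (x T) then 1 else 0 := rfl
    rw [e]
    unfold mistakesC
    rw [Finset.range_add_one, Finset.filter_insert]
    by_cases h : predC X Lrn x (fun t => f (x t)) T ≠ f (x T)
    · rw [if_pos h, if_pos h, Finset.card_insert_of_notMem (by simp)]
    · rw [if_neg h, if_neg h, add_zero]

/-! ### Second moment for lines in the affine plane -/

theorem exists_balanced (q : ℕ) [Fact q.Prime] (w : ZMod q × ZMod q → ℝ) (K : ℝ)
    (h0 : ∀ l, 0 ≤ w l) (hK : ∀ l, w l ≤ K) (hbig : 16 * q * K ≤ ∑ l, w l) :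
    ∃ a b : ZMod q,
      3 / (4 * q) * (∑ l, w l) ≤ ∑ l, (if b = a * l.1 + l.2 then w l else 0) ∧
      ∑ l, (if b = a * l.1 + l.2 then w l else 0) ≤ 5 / (4 * q) * (∑ l, w l) := by
  have hq0 : (0 : ℝ) < q := by exact_mod_cast (Fact.out : q.Prime).pos
  set Φ := ∑ l, w l with hΦ
  have hΦ0 : 0 ≤ Φ := Finset.sum_nonneg (fun l _ => h0 l)
  let S : ZMod q → ZMod q → ℝ := fun a b => ∑ l, (if b = a * l.1 + l.2 then w l else 0)
  have hcard : (Fintype.card (ZMod q) : ℝ) = q := by rw [ZMod.card]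
  have hS1 : ∀ a, ∑ b, S a b = Φ := by
    intro a
    simp only [S]
    rw [Finset.sum_comm]
    simp [hΦ]
  have hS2 : ∀ a, ∑ b, (S a b) ^ 2 =
      ∑ l, ∑ m, (if a * l.1 + l.2 = a * m.1 + m.2 then w l * w m else 0) := by
    intro a
    simp only [S, sq, Finset.sum_mul_sum]
    rw [Finset.sum_comm]
    refine Finset.sum_congr rfl fun l _ => ?_
    rw [Finset.sum_comm]
    refine Finset.sum_congr rfl fun m _ => ?_
    simp [ite_mul, mul_ite, eq_comm]
  have hcount : ∀ l m : ZMod q × ZMod q,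
      ∑ a : ZMod q, (if a * l.1 + l.2 = a * m.1 + m.2 then w l * w m else 0)
        ≤ w l * w m + (if l = m then q * (w l * w m) else 0) := by
    intro l m
    have hw : 0 ≤ w l * w m := mul_nonneg (h0 l) (h0 m)
    rw [← Finset.sum_filter, Finset.sum_const, nsmul_eq_mul]
    by_cases hlm : l = m
    · subst hlm
      rw [if_pos rfl]
      have : (((Finset.univ.filter fun a : ZMod q => a * l.1 + l.2 = a * l.1 + l.2).card : ℕ) : ℝ)
          = q := by simp [ZMod.card]
      rw [this]; linarith
    · simp only [if_neg hlm, add_zero]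
      have : (Finset.univ.filter fun a : ZMod q => a * l.1 + l.2 = a * m.1 + m.2).card ≤ 1 := by
        rw [Finset.card_le_one]
        intro a ha a' ha'
        simp only [Finset.mem_filter, Finset.mem_univ, true_and] at ha ha'
        by_contra hne
        have h1 : (a - a') * (l.1 - m.1) = 0 := by linear_combination ha - ha'
        rcases mul_eq_zero.1 h1 with h | h
        · exact hne (sub_eq_zero.1 h)
        · have e1 : l.1 = m.1 := sub_eq_zero.1 h
          apply hlm
          refine Prod.ext e1 ?_
          rw [e1] at ha
          exact add_left_cancel ha
      have : (((Finset.univ.filter fun a : ZMod q =>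
          a * l.1 + l.2 = a * m.1 + m.2).card : ℕ) : ℝ) ≤ 1 := by exact_mod_cast this
      nlinarith
  have hS2t : ∑ a, ∑ b, (S a b) ^ 2 ≤ Φ ^ 2 + Φ ^ 2 / 16 := by
    calc ∑ a, ∑ b, (S a b) ^ 2
        = ∑ l, ∑ m, ∑ a, (if a * l.1 + l.2 = a * m.1 + m.2 then w l * w m else 0) := by
          simp only [hS2]
          rw [Finset.sum_comm]
          refine Finset.sum_congr rfl fun l _ => ?_
          rw [Finset.sum_comm]
      _ ≤ ∑ l, ∑ m, (w l * w m + (if l = m then q * (w l * w m) else 0)) :=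
          Finset.sum_le_sum fun l _ => Finset.sum_le_sum fun m _ => hcount l m
      _ = Φ ^ 2 + ∑ l, q * (w l * w l) := by
          simp only [Finset.sum_add_distrib]
          congr 1
          · rw [sq, hΦ, Finset.sum_mul_sum]
          · simp
      _ ≤ Φ ^ 2 + ∑ l, q * (K * w l) := by
          gcongr with l _
          · exact h0 l
          · exact hK l
      _ = Φ ^ 2 + q * K * Φ := by
          rw [← Finset.mul_sum, ← Finset.mul_sum]; ring
      _ ≤ Φ ^ 2 + Φ ^ 2 / 16 := by nlinarith
  have hvar : ∑ a, ∑ b, (S a b - Φ / q) ^ 2 ≤ Φ ^ 2 / 16 := by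
    have e : ∑ a, ∑ b, (S a b - Φ / q) ^ 2 = ∑ a, ∑ b, (S a b) ^ 2 - Φ ^ 2 := by
      have : ∀ a, ∑ b, (S a b - Φ / q) ^ 2 = ∑ b, (S a b) ^ 2 - Φ ^ 2 / q := by
        intro a
        have : ∀ b, (S a b - Φ / q) ^ 2 = (S a b) ^ 2 - (2 * Φ / q) * S a b + (Φ / q) ^ 2 := by
          intro b; ring
        simp only [this, Finset.sum_add_distrib, Finset.sum_sub_distrib, ← Finset.mul_sum, hS1]
        simp only [Finset.sum_const, Finset.card_univ, nsmul_eq_mul, hcard]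
        field_simp
        ring
      simp only [this, Finset.sum_sub_distrib]
      simp only [Finset.sum_const, Finset.card_univ, nsmul_eq_mul, hcard]
      field_simp
    linarith
  by_contra! hno
  have hall : ∀ a b, Φ ^ 2 / (16 * q ^ 2) < (S a b - Φ / q) ^ 2 := by
    intro a b
    have e1 : Φ ^ 2 / (16 * q ^ 2) = (Φ / (4 * q)) ^ 2 := by field_simp; norm_num
    have e2 : 3 / (4 * q) * Φ = Φ / q - Φ / (4 * q) := by field_simp; ring
    have e3 : 5 / (4 * q) * Φ = Φ / q + Φ / (4 * q) := by field_simp; ring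
    have hpos : 0 ≤ Φ / (4 * q) := by positivity
    rw [e1]
    by_cases h : 3 / (4 * q) * Φ ≤ S a b
    · have := hno a b h
      change 5 / (4 * q) * Φ < S a b at this
      nlinarith
    · push Not at h
      nlinarith
  have hlt : ∑ a : ZMod q, ∑ b : ZMod q, Φ ^ 2 / (16 * q ^ 2) < ∑ a, ∑ b, (S a b - Φ / q) ^ 2 :=
    Finset.sum_lt_sum_of_nonempty Finset.univ_nonempty fun a _ =>
      Finset.sum_lt_sum_of_nonempty Finset.univ_nonempty fun b _ => hall a b
  simp only [Finset.sum_const, Finset.card_univ, nsmul_eq_mul, hcard] at hlt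
  have : (q : ℝ) * (q * (Φ ^ 2 / (16 * q ^ 2))) = Φ ^ 2 / 16 := by field_simp
  linarith

/-! ### The class -/

/-- The instance space: block index, field size, and two coordinates. -/
abbrev Inst : Type := ℕ × ℕ × ℕ × ℕ

/-- The hypothesis: one line per block. -/
def lineHyp (d q : ℕ) (l : ℕ → ZMod q × ZMod q) : Inst → Bool := fun x =>
  decide (x.1 < d ∧ x.2.1 = q ∧
    ((x.2.2.2 : ℕ) : ZMod q) = ((x.2.2.1 : ℕ) : ZMod q) * (l x.1).1 + (l x.1).2)

/-- The hypothesis class. -/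
def lineClass (d : ℕ) : Set (Inst → Bool) :=
  {h | ∃ q : ℕ, q.Prime ∧ ∃ l : ℕ → ZMod q × ZMod q, h = lineHyp d q l}

theorem lineHyp_true {d q : ℕ} {l : ℕ → ZMod q × ZMod q} {x : Inst} :
    lineHyp d q l x = true ↔ (x.1 < d ∧ x.2.1 = q ∧
    ((x.2.2.2 : ℕ) : ZMod q) = ((x.2.2.1 : ℕ) : ZMod q) * (l x.1).1 + (l x.1).2) := by
  simp [lineHyp]

theorem shatters_path {X : Type} [Inhabited X] {H : Set (X → Bool)} {m : ℕ} (hs : Shatters H m) :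
    ∃ x : ℕ → X, (∃ h ∈ H, ∀ i < m, h (x i) = true) ∧
      ∀ i < m, ∃ g ∈ H, (∀ j < i, g (x j) = true) ∧ g (x i) = false := by
  have hne : ∀ (G : Set (X → Bool)) (k : ℕ), Shatters G k → G.Nonempty := by
    intro G k hk
    induction hk with
    | zero _ hne => exact hne
    | succ _ _ _ _ _ ih0 _ => exact ih0.mono (fun _ h => h.1)
  induction hs with
  | zero H hne' =>
    obtain ⟨h, hh⟩ := hne'
    exact ⟨fun _ => default, ⟨h, hh, by simp⟩, by simp⟩
  | succ H d x h0 h1 ih0 ih1 =>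
    obtain ⟨xs, ⟨h, hh, hx⟩, hg⟩ := ih1
    refine ⟨fun i => Nat.casesOn i x xs, ⟨h, hh.1, ?_⟩, ?_⟩
    · intro i hi
      cases i with
      | zero => exact hh.2
      | succ i => exact hx i (by omega)
    · intro i hi
      cases i with
      | zero =>
        obtain ⟨g, hg⟩ := hne _ _ h0
        exact ⟨g, hg.1, by simp, hg.2⟩
      | succ i =>
        obtain ⟨g, hgH, hg1, hg2⟩ := hg i (by omega)
        refine ⟨g, hgH.1, ?_, hg2⟩
        intro j hj
        cases j with
        | zero => exact hgH.2
        | succ j => exact hg1 j (by omega)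

theorem line_unique {q : ℕ} [Fact q.Prime] {a b a' b' : ZMod q} {l m : ZMod q × ZMod q}
    (h1 : b = a * l.1 + l.2) (h2 : b' = a' * l.1 + l.2)
    (h3 : b = a * m.1 + m.2) (h4 : b' = a' * m.1 + m.2) (hne : a ≠ a') : l = m := by
  have h : (a - a') * (l.1 - m.1) = 0 := by linear_combination h3 - h1 + h2 - h4
  have e1 : l.1 = m.1 := by
    rcases mul_eq_zero.1 h with h | h
    · exact absurd (sub_eq_zero.1 h) hne
    · exact sub_eq_zero.1 h
  refine Prod.ext e1 ?_
  rw [h1, e1] at h3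
  exact add_left_cancel h3

theorem lineClass_dim (d m : ℕ) (hs : Shatters (lineClass d) m) : m ≤ 2 * d := by
  obtain ⟨x, ⟨h, ⟨q, hq, l, rfl⟩, hx⟩, hg⟩ := shatters_path hs
  have : Fact q.Prime := ⟨hq⟩
  -- no three indices in the same block
  have key : ∀ i j k, i < j → j < k → k < m → (x i).1 = (x j).1 → (x j).1 = (x k).1 → False := by
    intro i j k hij hjk hkm e1 e2
    obtain ⟨hi1, hi2, hi3⟩ := lineHyp_true.1 (hx i (by omega))
    obtain ⟨hj1, hj2, hj3⟩ := lineHyp_true.1 (hx j (by omega))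
    obtain ⟨hk1, hk2, hk3⟩ := lineHyp_true.1 (hx k (by omega))
    obtain ⟨g, ⟨q', hq', l', rfl⟩, gk, gkk⟩ := hg k hkm
    obtain ⟨gi1, gi2, gi3⟩ := lineHyp_true.1 (gk i (by omega))
    have hqq : q' = q := gi2.symm.trans hi2
    subst hqq
    obtain ⟨gj1, gj2, gj3⟩ := lineHyp_true.1 (gk j (by omega))
    obtain ⟨f, ⟨q'', hq'', l'', rfl⟩, fk, fkk⟩ := hg j (by omega)
    obtain ⟨fi1, fi2, fi3⟩ := lineHyp_true.1 (fk i (by omega))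
    have hqq : q'' = q' := fi2.symm.trans hi2
    subst hqq
    rw [e1] at hi3 gi3 fi3
    have hne : (((x i).2.2.1 : ℕ) : ZMod q'') ≠ (((x j).2.2.1 : ℕ) : ZMod q'') := by
      intro he
      have : lineHyp d q'' l'' (x j) = true := by
        rw [lineHyp_true]
        refine ⟨hj1, hj2, ?_⟩
        rw [← he, ← fi3, hi3, he, hj3]
      rw [this] at fkk
      cases fkk
    have hll := line_unique hi3 hj3 gi3 gj3 hne
    have : lineHyp d q'' l' (x k) = true := by
      rw [lineHyp_true]
      refine ⟨hk1, hk2, ?_⟩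
      rw [← e2, ← hll, e2]; exact hk3
    rw [this] at gkk
    cases gkk
  have hcard := Finset.card_le_mul_card_image_of_maps_to (s := Finset.range m)
    (t := Finset.range d) (f := fun i => (x i).1)
    (fun i hi => by
      have := lineHyp_true.1 (hx i (Finset.mem_range.1 hi))
      exact Finset.mem_range.2 this.1) 2 (by
      intro b _
      by_contra! hc
      rw [Finset.two_lt_card] at hc
      obtain ⟨i, hi, j, hj, k, hk, hij, hik, hjk⟩ := hc
      simp only [Finset.mem_filter, Finset.mem_range] at hi hj hk
      have := key i j k
      have := key i k j
      have := key j i k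
      have := key j k i
      have := key k i j
      have := key k j i
      grind)
  simpa using hcard

/-! ### One block of the adversary -/

theorem block (q : ℕ) [Fact q.Prime] (hq : 16 ≤ q) (Lrn : ConceptLearner Inst)
    (d j : ℕ) (hj : j < d) (L0 : ℕ → ZMod q × ZMod q) (n : ℕ) :
    ∀ (h0 : List (Inst × Option Bool)) (w : ZMod q × ZMod q → ℝ),
      (∀ l, 0 ≤ w l) → (∀ l, w l ≤ q / 16) → (q : ℝ) ^ 2 ≤ ∑ l, w l →
      (q : ℝ) ^ 2 * (q / 16) < (∑ l, w l) * (1 + 1 / (q : ℝ) ^ 2) ^ n →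
      ∃ (xs : List Inst) (l : ZMod q × ZMod q), xs.length = n ∧ (∀ x ∈ xs, x.1 = j) ∧
        (q : ℝ) / 16 < w l *
          (1 + 2 / (q : ℝ)) ^ (runMist Lrn (lineHyp d q (Function.update L0 j l)) h0 xs) := by
  have hqR : (16 : ℝ) ≤ q := by exact_mod_cast hq
  have hq0 : (0 : ℝ) < q := by linarith
  induction n with
  | zero =>
    intro h0 w hw0 hwK hΦ hend
    exfalso
    have : ∑ l, w l ≤ ∑ l : ZMod q × ZMod q, (q : ℝ) / 16 := Finset.sum_le_sum fun l _ => hwK l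
    simp only [Finset.sum_const, Finset.card_univ, Fintype.card_prod, ZMod.card, nsmul_eq_mul] at this
    push_cast at this
    simp only [pow_zero, mul_one] at hend
    nlinarith
  | succ n ih =>
    intro h0 w hw0 hwK hΦ hend
    obtain ⟨a, b, hlo, hhi⟩ := exists_balanced q w (q / 16) hw0 hwK (by nlinarith)
    let x : Inst := (j, q, a.val, b.val)
    have hfx : ∀ l, lineHyp d q (Function.update L0 j l) x = decide (b = a * l.1 + l.2) := by
      intro l
      simp [lineHyp, x, hj]
    let p : Bool := Lrn h0 x
    let w' : ZMod q × ZMod q → ℝ := fun l =>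
      if p = true then (if b = a * l.1 + l.2 then 0 else w l * (1 + 2 / q))
      else (if b = a * l.1 + l.2 then w l * (1 + 2 / q) else w l)
    have hw'0 : ∀ l, 0 ≤ w' l := by
      intro l
      have := hw0 l
      simp only [w']
      split_ifs <;> positivity
    have hgrow : (∑ l, w l) * (1 + 1 / (q : ℝ) ^ 2) ≤ ∑ l, w' l := by
      set Φ := ∑ l, w l with hΦdef
      set S := ∑ l, (if b = a * l.1 + l.2 then w l else 0) with hS
      have hΦ0 : 0 ≤ Φ := Finset.sum_nonneg (fun l _ => hw0 l)
      by_cases hp : p = true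
      · have e : ∑ l, w' l = (Φ - S) * (1 + 2 / q) := by
          rw [hΦdef, hS, ← Finset.sum_sub_distrib, Finset.sum_mul]
          refine Finset.sum_congr rfl fun l _ => ?_
          simp only [w', hp, if_true]
          split_ifs <;> ring
        rw [e]
        have h1 : Φ * (1 + 1 / (q : ℝ) ^ 2) ≤ (Φ - 5 / (4 * q) * Φ) * (1 + 2 / q) := by
          have : (Φ - 5 / (4 * q) * Φ) * (1 + 2 / q) - Φ * (1 + 1 / (q : ℝ) ^ 2)
              = Φ * ((3 * q - 14) / (4 * q ^ 2)) := by field_simp; ring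
          have h2 : 0 ≤ Φ * ((3 * q - 14) / (4 * (q : ℝ) ^ 2)) := by
            apply mul_nonneg hΦ0
            apply div_nonneg <;> nlinarith
          linarith
        refine h1.trans ?_
        gcongr
      · have e : ∑ l, w' l = Φ + S * (2 / q) := by
          rw [hΦdef, hS, Finset.sum_mul, ← Finset.sum_add_distrib]
          refine Finset.sum_congr rfl fun l _ => ?_
          simp only [w', if_neg hp]
          split_ifs <;> ring
        rw [e]
        have h1 : Φ * (1 + 1 / (q : ℝ) ^ 2) ≤ Φ + (3 / (4 * q) * Φ) * (2 / q) := by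
          have : Φ + (3 / (4 * q) * Φ) * (2 / q) - Φ * (1 + 1 / (q : ℝ) ^ 2)
              = Φ * (1 / (2 * q ^ 2)) := by field_simp; ring
          have h2 : 0 ≤ Φ * (1 / (2 * (q : ℝ) ^ 2)) := by positivity
          linarith
        refine h1.trans ?_
        gcongr
    have hone : (1 : ℝ) ≤ 1 + 2 / q := by
      have : (0 : ℝ) ≤ 2 / q := by positivity
      linarith
    -- a step of the run multiplies the weight
    have hstep : ∀ l, 0 < w' l → ∀ xs,
        w' l * (1 + 2 / (q : ℝ)) ^ (runMist Lrn (lineHyp d q (Function.update L0 j l))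
            (h0 ++ [(x, if p = true then some false else none)]) xs) =
        w l * (1 + 2 / (q : ℝ)) ^ (runMist Lrn (lineHyp d q (Function.update L0 j l))
            h0 (x :: xs)) := by
      intro l hl xs
      simp only [runMist, hfx]
      change _ = w l * (1 + 2 / (q : ℝ)) ^ ((if p ≠ _ then 1 else 0) +
        runMist Lrn _ (h0 ++ [(x, if p = true then _ else none)]) xs)
      by_cases hp : p = true
      · by_cases hb : b = a * l.1 + l.2
        · simp [w', hp, hb] at hl
        · simp only [w', hp, hb, if_true, if_false, decide_false, ne_eq, Bool.true_eq_false,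
            not_false_eq_true, pow_add, pow_one]
          ring
      · have hp' : p = false := by simpa using hp
        by_cases hb : b = a * l.1 + l.2
        · simp only [w', hp', ← hb, if_true, if_false, decide_true, ne_eq, Bool.false_eq_true,
            not_false_eq_true, pow_add, pow_one]
          ring
        · simp [w', hp', hb]
    by_cases hover : ∃ l, (q : ℝ) / 16 < w' l
    · obtain ⟨l, hl⟩ := hover
      have hlpos : 0 < w' l := lt_trans (by positivity) hl
      refine ⟨x :: List.replicate n x, l, by simp, ?_, ?_⟩
      · intro z hz
        have : z = x := by
          rcases List.mem_cons.1 hz with h | h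
          · exact h
          · exact (List.mem_replicate.1 h).2
        rw [this]
      · rw [← hstep l hlpos]
        exact lt_of_lt_of_le hl (le_mul_of_one_le_right hlpos.le (one_le_pow₀ hone))
    · push Not at hover
      have hmul : (1 : ℝ) ≤ 1 + 1 / (q : ℝ) ^ 2 := by
        have : (0 : ℝ) ≤ 1 / (q : ℝ) ^ 2 := by positivity
        linarith
      obtain ⟨xs, l, hlen, htag, hfin⟩ := ih
        (h0 ++ [(x, if p = true then some false else none)]) w' hw'0 hover
        (by nlinarith [sq_nonneg (q : ℝ)])
        (by
          refine hend.trans_le ?_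
          rw [pow_succ, mul_comm _ (1 + 1 / (q : ℝ) ^ 2), ← mul_assoc]
          gcongr)
      have hlpos : 0 < w' l := by
        rcases (hw'0 l).lt_or_eq with h | h
        · exact h
        · rw [← h, zero_mul] at hfin
          have : (0 : ℝ) < q / 16 := by positivity
          linarith
      refine ⟨x :: xs, l, by simp [hlen], ?_, ?_⟩
      · intro z hz
        rcases List.mem_cons.1 hz with h | h
        · rw [h]
        · exact htag z h
      · rw [← hstep l hlpos]
        exact hfin

theorem blocks (q : ℕ) [Fact q.Prime] (hq : 16 ≤ q) (Lrn : ConceptLearner Inst)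
    (d n : ℕ) (hn : (q : ℝ) / 16 < (1 + 1 / (q : ℝ) ^ 2) ^ n) (j : ℕ) (hj : j ≤ d) :
    ∃ (xs : List Inst) (L : ℕ → ZMod q × ZMod q), xs.length = j * n ∧ (∀ x ∈ xs, x.1 < j) ∧
      (j : ℝ) * (q / 2 * Real.log (q / 16)) ≤ runMist Lrn (lineHyp d q L) [] xs := by
  have hqR : (16 : ℝ) ≤ q := by exact_mod_cast hq
  have hq0 : (0 : ℝ) < q := by linarith
  induction j with
  | zero => exact ⟨[], fun _ => 0, by simp, by simp, by simp⟩
  | succ j ih =>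
    obtain ⟨xs, L, hlen, htag, hm⟩ := ih (by omega)
    have hsum : ∑ l : ZMod q × ZMod q, (fun _ => (1 : ℝ)) l = (q : ℝ) ^ 2 := by
      simp [ZMod.card, sq]
    obtain ⟨ys, l, hlen', htag', hm'⟩ := block q hq Lrn d j (by omega) L n
      (runHist Lrn (lineHyp d q L) [] xs) (fun _ => 1) (by simp)
      (fun _ => by linarith) hsum.ge
      (by rw [hsum]; gcongr)
    have hagree : ∀ x ∈ xs, lineHyp d q (Function.update L j l) x = lineHyp d q L x := by
      intro x hx
      have hne : x.1 ≠ j := (htag x hx).ne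
      simp only [lineHyp, Function.update_of_ne hne]
    refine ⟨xs ++ ys, Function.update L j l, by simp [hlen, hlen']; ring, ?_, ?_⟩
    · intro x hx
      rcases List.mem_append.1 hx with h | h
      · exact (htag x h).trans (by omega)
      · rw [htag' x h]; omega
    · rw [runMist_append, runMist_congr Lrn _ _ xs [] hagree, runHist_congr Lrn _ _ xs [] hagree]
      set m := runMist Lrn (lineHyp d q (Function.update L j l))
        (runHist Lrn (lineHyp d q L) [] xs) ys with hmdef
      rw [one_mul] at hm'
      have hlog : Real.log (q / 16) ≤ m * (2 / q) := by
        have h1 := Real.log_le_log (by positivity) hm'.le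
        rw [Real.log_pow] at h1
        have h2 : Real.log (1 + 2 / (q : ℝ)) ≤ 2 / q := by
          have := Real.log_le_sub_one_of_pos (show (0 : ℝ) < 1 + 2 / q by positivity)
          linarith
        exact h1.trans (by gcongr)
      have h3 : (q : ℝ) / 2 * Real.log (q / 16) ≤ m := by
        calc (q : ℝ) / 2 * Real.log (q / 16) ≤ q / 2 * (m * (2 / q)) := by gcongr
          _ = m := by field_simp
      push_cast
      linarith

/-- Everything for a fixed prime. -/
theorem fixed_prime (q : ℕ) [Fact q.Prime] (hq : 16 ≤ q) (Lrn : ConceptLearner Inst)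
    (d n T : ℕ) (hn : (q : ℝ) / 16 < (1 + 1 / (q : ℝ) ^ 2) ^ n) (hT : d * n ≤ T) :
    ∃ (x : ℕ → Inst) (y : ℕ → Bool), (∃ h ∈ lineClass d, ∀ t < T, h (x t) = y t) ∧
      (d : ℝ) * (q / 2 * Real.log (q / 16)) ≤ mistakesC Inst Lrn x y T := by
  obtain ⟨xs, L, hlen, -, hm⟩ := blocks q hq Lrn d n hn d le_rfl
  let x : ℕ → Inst := fun t => xs.getD t default
  refine ⟨x, fun t => lineHyp d q L (x t), ⟨_, ⟨q, Fact.out, L, rfl⟩, fun _ _ => rfl⟩, ?_⟩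
  rw [mistakesC_eq]
  refine hm.trans ?_
  have hpre : xs = (List.range (d * n)).map x := by
    apply List.ext_getElem
    · simp [hlen]
    · intro i h1 h2
      simp [x, h1]
  obtain ⟨k, rfl⟩ := Nat.exists_eq_add_of_le hT
  rw [List.range_add, List.map_append, runMist_append, ← hpre]
  push_cast
  exact le_add_of_nonneg_right (by positivity)

theorem log_small (d : ℕ) (hd : 1 ≤ d) :
    ∃ T₀ : ℕ, ∀ T : ℕ, T₀ ≤ T → 4096 * (d : ℝ) * Real.log T ≤ Real.sqrt T := by
  have h := (isLittleO_log_rpow_atTop (show (0 : ℝ) < 1 / 2 by norm_num)).comp_tendsto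
    (tendsto_natCast_atTop_atTop (R := ℝ))
  have hd0 : (0 : ℝ) < d := by exact_mod_cast hd
  have h2 := h.bound (show (0 : ℝ) < 1 / (4096 * d) by positivity)
  obtain ⟨T₀, hT₀⟩ := Filter.eventually_atTop.1 h2
  refine ⟨T₀, fun T hT => ?_⟩
  have h3 := hT₀ T hT
  simp only [Function.comp, Real.norm_eq_abs] at h3
  rw [← Real.sqrt_eq_rpow, abs_of_nonneg (Real.sqrt_nonneg _)] at h3
  have h4 := (le_abs_self _).trans h3
  calc 4096 * (d : ℝ) * Real.log T ≤ 4096 * d * (1 / (4096 * d) * Real.sqrt T) := by gcongr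
    _ = Real.sqrt T := by field_simp

/-- Realizable lower bound for specific classes: there are universal constants `c > 0`,
`C` and `d₀` such that for every `d ≥ d₀` there exist a hypothesis class `H` with
Littlestone dimension at most `C·d` (i.e. `L(H) = O(d)`) and a threshold `T₀` such that
for all `T ≥ T₀`, every deterministic apple tasting learner makes at least
`c·√(dT log T)` mistakes on some realizable sequence of length `T`. -/
theorem specific_class_lower_bound :
    ∃ (c : ℝ) (C d₀ : ℕ), 0 < c ∧
      ∀ d : ℕ, d₀ ≤ d →
        ∃ (X : Type) (H : Set (X → Bool)) (T₀ : ℕ),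
          (∀ m : ℕ, Shatters H m → m ≤ C * d) ∧
          ∀ T : ℕ, T₀ ≤ T →
            ∀ Lrn : ConceptLearner X, ∃ (x : ℕ → X) (y : ℕ → Bool),
              (∃ h ∈ H, ∀ t < T, h (x t) = y t) ∧
              c * Real.sqrt ((d : ℝ) * T * Real.log T) ≤ (mistakesC X Lrn x y T : ℝ) := by
  refine ⟨1 / 32, 2, 1, by norm_num, ?_⟩
  intro d hd
  obtain ⟨T₁, hT₁⟩ := log_small d hd
  refine ⟨Inst, lineClass d, max T₁ (max 16 (2 * d)), lineClass_dim d, ?_⟩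
  intro T hT Lrn
  have hlogT := hT₁ T (le_trans (le_max_left _ _) hT)
  have hT16 : 16 ≤ T := le_trans (le_trans (le_max_left _ _) (le_max_right _ _)) hT
  have hT2d : 2 * d ≤ T := le_trans (le_trans (le_max_right _ _) (le_max_right _ _)) hT
  have hd1 : (1 : ℝ) ≤ d := by exact_mod_cast hd
  have hTR : (16 : ℝ) ≤ T := by exact_mod_cast hT16
  have hT2dR : 2 * (d : ℝ) ≤ T := by exact_mod_cast hT2d
  have hT0 : (0 : ℝ) < T := by linarith
  set Λ := Real.log T with hΛ
  have hΛ1 : 1 ≤ Λ := by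
    rw [hΛ, Real.le_log_iff_exp_le hT0]
    linarith [Real.exp_one_lt_d9]
  have hΛ0 : 0 < Λ := by linarith
  have hd0 : (0 : ℝ) < d := by linarith
  set r := Real.sqrt (T / (16 * d * Λ)) with hr
  have hr2 : r ^ 2 = T / (16 * d * Λ) := Real.sq_sqrt (by positivity)
  have hr0 : 0 ≤ r := Real.sqrt_nonneg _
  have hsT : Real.sqrt T ^ 2 = T := Real.sq_sqrt hT0.le
  have hsT1 : 1 ≤ Real.sqrt T := by
    rw [Real.one_le_sqrt]; linarith
  -- `(r / 16) ^ 2 ≥ √T`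
  have hr16 : Real.sqrt T ≤ (r / 16) ^ 2 := by
    have e : (r / 16) ^ 2 = T / (4096 * d * Λ) := by
      rw [div_pow, hr2]; field_simp; norm_num
    rw [e, le_div_iff₀ (by positivity)]
    nlinarith
  have hrge : 16 ≤ r := by nlinarith
  have hQ1 : 16 ≤ ⌊r⌋₊ := Nat.le_floor (by exact_mod_cast hrge)
  obtain ⟨q, hqp, hq1, hq2⟩ := Nat.exists_prime_lt_and_le_two_mul ⌊r⌋₊ (by omega)
  have : Fact q.Prime := ⟨hqp⟩
  have hq16 : 16 ≤ q := by omega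
  have hrq : r ≤ q := by
    have h1 := Nat.lt_floor_add_one r
    have h2 : ((⌊r⌋₊ : ℕ) : ℝ) + 1 ≤ q := by exact_mod_cast hq1
    linarith
  have hq2r : (q : ℝ) ≤ 2 * r := by
    have h1 := Nat.floor_le hr0
    have h2 : (q : ℝ) ≤ 2 * (⌊r⌋₊ : ℕ) := by exact_mod_cast hq2
    linarith
  have hqR : (16 : ℝ) ≤ q := by linarith
  have hq0 : (0 : ℝ) < q := by linarith
  have hqsq : (q : ℝ) ^ 2 ≤ T / (4 * d * Λ) := by
    have h1 : (q : ℝ) ^ 2 ≤ 4 * r ^ 2 := by nlinarith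
    have h2 : 4 * (T / (16 * d * Λ)) = T / (4 * d * Λ) := by field_simp; norm_num
    rw [hr2] at h1
    linarith
  have hqsq' : (q : ℝ) ^ 2 * (4 * d * Λ) ≤ T := (le_div_iff₀ (by positivity)).1 hqsq
  have hqT : (q : ℝ) ≤ T := by
    have : 1 ≤ 4 * d * Λ := by nlinarith
    nlinarith
  have hlogq : Real.log q ≤ Λ := Real.log_le_log hq0 hqT
  have hn1 : (T : ℝ) / (2 * d) ≤ ((T / d : ℕ) : ℝ) := by
    have h1 : T < d * (T / d + 1) := Nat.lt_mul_div_succ T (by omega)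
    have h2 : (T : ℝ) ≤ d * (((T / d : ℕ) : ℝ) + 1) := by exact_mod_cast h1.le
    rw [div_le_iff₀ (by positivity)]
    nlinarith
  have hn : (q : ℝ) / 16 < (1 + 1 / (q : ℝ) ^ 2) ^ (T / d) := by
    have hpos : (0 : ℝ) < 1 + 1 / (q : ℝ) ^ 2 := by positivity
    have h1 : 1 / (2 * (q : ℝ) ^ 2) ≤ Real.log (1 + 1 / (q : ℝ) ^ 2) := by
      refine le_trans ?_ (Real.one_sub_inv_le_log_of_pos hpos)
      have e : 1 - (1 + 1 / (q : ℝ) ^ 2)⁻¹ = 1 / ((q : ℝ) ^ 2 + 1) := by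
        field_simp; ring
      rw [e]
      apply one_div_le_one_div_of_le (by positivity)
      nlinarith
    have h2 : Λ ≤ ((T / d : ℕ) : ℝ) * (1 / (2 * (q : ℝ) ^ 2)) := by
      rw [mul_one_div, le_div_iff₀ (by positivity)]
      refine le_trans ?_ hn1
      rw [le_div_iff₀ (by positivity)]
      linarith
    have h3 : Real.log q ≤ Real.log ((1 + 1 / (q : ℝ) ^ 2) ^ (T / d)) := by
      rw [Real.log_pow]
      refine hlogq.trans (h2.trans ?_)
      gcongr
    have h4 := (Real.log_le_log_iff hq0 (by positivity)).1 h3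
    linarith
  obtain ⟨x, y, hreal, hm⟩ := fixed_prime q hq16 Lrn d (T / d) T hn (Nat.mul_div_le T d)
  refine ⟨x, y, hreal, le_trans ?_ hm⟩
  have hlog16 : Λ / 4 ≤ Real.log (q / 16) := by
    have h1 : Real.log (r / 16) ≤ Real.log (q / 16) :=
      Real.log_le_log (by positivity) (by linarith)
    have h2 := Real.log_le_log (by linarith) hr16
    rw [Real.log_pow, Real.log_sqrt hT0.le] at h2
    push_cast at h2
    linarith
  have e : Real.sqrt ((d : ℝ) * T * Λ) = 4 * d * Λ * r := by
    rw [Real.sqrt_eq_iff_mul_self_eq (by positivity) (by positivity)]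
    have : 4 * d * Λ * r * (4 * d * Λ * r) = 16 * d ^ 2 * Λ ^ 2 * r ^ 2 := by ring
    rw [this, hr2]
    field_simp
  rw [e]
  calc 1 / 32 * (4 * d * Λ * r) = d * (r / 2 * (Λ / 4)) := by ring
    _ ≤ d * (q / 2 * Real.log (q / 16)) := by gcongr
end
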